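/- arXiv:2307.07625 — 5 statements merged into one kernel-verified Lean document; each statement's English description precedes it below -/
import Mathlib

section
/- Let ν be a fully supported, b-marginally bounded probability measure on {±1}^n, let f : {±1}^n → {0,1} be monotone, and let k ∈ [n]. Then Pr_{X∼ν}[f(X_{∼k}, X_k → 1) = 1] ≥ Pr_{X∼ν}[f(X) = 1] + I_k(f)/(1 + b), where f(X_{∼k}, X_k → 1) denotes f evaluated at X with coordinate k replaced by 1. -/
open scoped Classical BigOperators

noncomputable section

abbrev Cfg (σ : Type) (n : ℕ) : Type := Fin n → σ

variable {σ : Type} [Fintype σ] [DecidableEq σ] {n : ℕ}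

/-- Expectation of `f` under the discrete measure `ν`. -/
def expct (ν f : Cfg σ n → ℝ) : ℝ := ∑ x, ν x * f x

/-- Variance of `f` under `ν`. -/
def varnc (ν f : Cfg σ n → ℝ) : ℝ := expct ν (fun x => (f x - expct ν f) ^ 2)

/-- ν is a fully supported probability measure. -/
def IsProb (ν : Cfg σ n → ℝ) : Prop := (∀ x, 0 < ν x) ∧ ∑ x, ν x = 1

/-- `(P_i f)(x) = E[f(X) | X_j = x_j ∀ j ≠ i]`. -/
def Pop (ν : Cfg σ n → ℝ) (i : Fin n) (f : Cfg σ n → ℝ) (x : Cfg σ n) : ℝ :=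
  (∑ y ∈ Finset.univ.filter (fun y : Cfg σ n => ∀ j, j ≠ i → y j = x j), ν y * f y) /
    (∑ y ∈ Finset.univ.filter (fun y : Cfg σ n => ∀ j, j ≠ i → y j = x j), ν y)

/-- `L_i f = P_i f - f`. -/
def Lop (ν : Cfg σ n → ℝ) (i : Fin n) (f : Cfg σ n → ℝ) (x : Cfg σ n) : ℝ :=
  Pop ν i f x - f x

/-- `‖f‖_p = (E_ν |f|^p)^{1/p}`. -/
def pnorm (ν : Cfg σ n → ℝ) (p : ℝ) (f : Cfg σ n → ℝ) : ℝ :=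
  (∑ x, ν x * |f x| ^ p) ^ (1 / p)

/-- Relative-entropy functional `Ent_ν[g]`. -/
def entFun (ν g : Cfg σ n → ℝ) : ℝ :=
  expct ν (fun x => g x * Real.log (g x)) - expct ν g * Real.log (expct ν g)

/-- The log-Sobolev inequality with constant `ρ` for the Glauber dynamics of `ν`. -/
def LogSobolev (ν : Cfg σ n → ℝ) (ρ : ℝ) : Prop :=
  ∀ g : Cfg σ n → ℝ, (∀ x, 0 ≤ g x) →
    ρ * entFun ν g ≤ 2 * ∑ i : Fin n, expct ν (fun x => (Lop ν i (fun y => Real.sqrt (g y)) x) ^ 2)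

/-- `ν` is `b`-marginally bounded. -/
def MargBounded (ν : Cfg σ n → ℝ) (b : ℝ) : Prop :=
  ∀ x y : Cfg σ n, hammingDist x y = 1 → 1 / b ≤ ν x / ν y ∧ ν x / ν y ≤ b

/-- Conditional probability `Pr[X_i = a | X_j = x_j ∀ j ≠ i]`. -/
def condProb (ν : Cfg σ n → ℝ) (i : Fin n) (x : Cfg σ n) (a : σ) : ℝ :=
  ν (Function.update x i a) / ∑ a' : σ, ν (Function.update x i a')

/-- `ν` is a Markov random field w.r.t. `G`: the conditional law of `X_i` given all other
coordinates depends only on the neighbors of `i` in `G`. -/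
def IsMRF (ν : Cfg σ n → ℝ) (G : SimpleGraph (Fin n)) : Prop :=
  ∀ (i : Fin n) (x y : Cfg σ n), (∀ j, G.Adj i j → x j = y j) →
    ∀ a : σ, condProb ν i x a = condProb ν i y a

/-- The graph `G` has maximum degree at most `Δ`. -/
def MaxDegLE {m : ℕ} (G : SimpleGraph (Fin m)) (Δ : ℕ) : Prop :=
  ∀ i, (Finset.univ.filter fun j => G.Adj i j).card ≤ Δ

/-- Assumption A: fully supported probability measure, `b`-marginally bounded,
log-Sobolev with constant `ρ ∈ (0,1]`, and an MRF w.r.t. a graph of max degree `Δ`. -/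
def AssumptionA (ν : Cfg σ n → ℝ) (b ρ : ℝ) (Δ : ℕ) : Prop :=
  IsProb ν ∧ 1 ≤ b ∧ MargBounded ν b ∧ 0 < ρ ∧ ρ ≤ 1 ∧ LogSobolev ν ρ ∧
    ∃ G : SimpleGraph (Fin n), IsMRF ν G ∧ MaxDegLE G Δ

/-- Influence of coordinate `i` on `f`. -/
def influence (ν : Cfg σ n → ℝ) (f : Cfg σ n → ℝ) (i : Fin n) : ℝ :=
  ∑ x ∈ Finset.univ.filter (fun x : Cfg σ n => ∃ a : σ, f (Function.update x i a) ≠ f x), ν x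

/-- Two configurations that differ only at coordinate `k` have comparable mass. -/
lemma MargBounded.update_true_le {n : ℕ} {ν : Cfg Bool n → ℝ} (hν : IsProb ν) {b : ℝ}
    (hmb : MargBounded ν b) (k : Fin n) (x : Cfg Bool n) :
    ν (Function.update x k true) ≤ b * ν (Function.update x k false) := by
  have hd : hammingDist (Function.update x k true) (Function.update x k false) = 1 := by
    have : (Finset.univ.filter fun i =>
        Function.update x k true i ≠ Function.update x k false i) = {k} := by
      ext i
      by_cases hi : i = k
      · subst hi; simp
      · simp [hi]
    unfold hammingDist
    convert Finset.card_singleton k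
  exact (div_le_iff₀ (hν.1 _)).1 (hmb _ _ hd).2

/-- A sum over the Boolean cube is nonnegative if it is so on every edge in direction `k`. -/
lemma sum_nonneg_of_edge_nonneg {n : ℕ} (g : Cfg Bool n → ℝ) (k : Fin n)
    (h : ∀ x, 0 ≤ g (Function.update x k false) + g (Function.update x k true)) :
    0 ≤ ∑ x, g x := by
  have hinv : Function.Involutive fun x : Cfg Bool n => Function.update x k (!x k) := by
    intro x
    simp
  have hflip : ∑ x, g (Function.update x k (!x k)) = ∑ x, g x :=
    hinv.bijective.sum_comp g
  have hsum : 0 ≤ ∑ x, (g x + g (Function.update x k (!x k))) := by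
    refine Finset.sum_nonneg fun x _ => ?_
    have hx := h x
    have hself := Function.update_eq_self k x
    cases hk : x k <;> rw [hk] at hself <;> rw [hself] at hx
    · simpa using hx
    · simpa [add_comm] using hx
  rw [Finset.sum_add_distrib, hflip] at hsum
  linarith

/-- **Flipping one coordinate of a monotone function gains its influence over `1+b`**
(from the proof of Corollary 3.10). Preferences in `{±1}` are encoded by `Bool`, `true`
playing the role of `+1`. If `ν` is fully supported and `b`-marginally bounded and
`f : {±1}^n → {0,1}` is monotone, then for every `k`,
`Pr[f(X_{∼k}, X_k → 1) = 1] ≥ Pr[f(X) = 1] + I_k(f)/(1+b)`. -/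
theorem monotone_flip_gain {n : ℕ} (ν : Cfg Bool n → ℝ) (hν : IsProb ν)
    (b : ℝ) (hb : 1 ≤ b) (hmb : MargBounded ν b)
    (f : Cfg Bool n → ℝ) (hf : ∀ x, f x = 0 ∨ f x = 1)
    (hmono : ∀ x y : Cfg Bool n, (∀ i, x i ≤ y i) → f x ≤ f y) (k : Fin n) :
    (∑ x ∈ Finset.univ.filter (fun x : Cfg Bool n => f x = 1), ν x) +
        influence ν f k / (1 + b) ≤
      ∑ x ∈ Finset.univ.filter
          (fun x : Cfg Bool n => f (Function.update x k true) = 1), ν x := by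
  have hb1 : 0 < 1 + b := by linarith
  have key : 0 ≤ ∑ x, ((1 + b) * ((if f (Function.update x k true) = 1 then ν x else 0) -
      (if f x = 1 then ν x else 0)) -
      (if ∃ a : Bool, f (Function.update x k a) ≠ f x then ν x else 0)) := by
    refine sum_nonneg_of_edge_nonneg _ k fun x => ?_
    have hle := hmb.update_true_le hν k x
    have hm : f (Function.update x k false) ≤ f (Function.update x k true) := by
      refine hmono _ _ fun i => ?_
      by_cases hi : i = k
      · subst hi; simp
      · simp [hi]
    rcases hf (Function.update x k false) with h0 | h0 <;>
      rcases hf (Function.update x k true) with h1 | h1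
    · simp [h0, h1]
    · simp [h0, h1]
      linarith
    · rw [h0, h1] at hm
      norm_num at hm
    · simp [h0, h1]
  rw [Finset.sum_sub_distrib, ← Finset.mul_sum, Finset.sum_sub_distrib] at key
  simp only [← Finset.sum_filter] at key
  have hinf := (div_le_iff₀' hb1).2 (sub_nonneg.1 key)
  have heq : influence ν f k =
      ∑ x with ∃ a : Bool, f (Function.update x k a) ≠ f x, ν x := by
    unfold influence
    congr!
  rw [← heq] at hinf
  linarith
end
end

section
/- Let 0 < c ≤ 1 and 0 < ε < 1/2, and let (p_t)_{t≥0} be a sequence with ε ≤ p_0, p_t ≤ 1 for all t, and p_{t+1} ≥ p_t + c·p_t·(1 − p_t) for all t ≥ 0. Then p_t ≥ 1 − ε for every integer t ≥ (4/c)·log(1/(2ε)). -/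
/-- Lower bound for `exp (-c / 2)` by a cubic polynomial on `[0, 1]`. -/
lemma cubic_le_exp_neg_half {c : ℝ} (hc0 : 0 ≤ c) (hc1 : c ≤ 1) :
    1 - c / 2 + c ^ 2 / 8 - c ^ 3 / 40 ≤ Real.exp (-c / 2) := by
  have hb : |(-c / 2 : ℝ)| ≤ 1 := by
    rw [abs_le]; constructor <;> linarith
  have h := (abs_le.mp (Real.exp_bound hb (n := 4) (by norm_num))).1
  have habs : |(-c / 2 : ℝ)| = c / 2 := by
    rw [abs_of_nonpos (by linarith)]; ring
  rw [habs] at h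
  norm_num [Finset.sum_range_succ, Nat.factorial] at h
  have h3 : c ^ 4 ≤ c ^ 3 := pow_le_pow_of_le_one hc0 hc1 (by norm_num)
  nlinarith [pow_nonneg hc0 3]

/-- Upper bound for `exp (c / 2)` by a cubic polynomial on `[0, 1]`. -/
lemma exp_half_le_cubic {c : ℝ} (hc0 : 0 ≤ c) (hc1 : c ≤ 1) :
    Real.exp (c / 2) ≤ 1 + c / 2 + c ^ 2 / 8 + c ^ 3 / 30 := by
  have h := Real.exp_bound' (x := c / 2) (by linarith) (by linarith) (n := 4) (by norm_num)
  norm_num [Finset.sum_range_succ, Nat.factorial] at h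
  have h3 : c ^ 4 ≤ c ^ 3 := pow_le_pow_of_le_one hc0 hc1 (by norm_num)
  nlinarith [pow_nonneg hc0 3]

/-- A potential that contracts under the logistic gain. -/
noncomputable def gainPotential (x : ℝ) : ℝ :=
  if x ≤ 1 / 2 then 1 / (2 * x) else 2 * (1 - x)

lemma gainPotential_step {c x y : ℝ} (hc0 : 0 < c) (hc1 : c ≤ 1) (hx0 : 0 < x) (hx1 : x ≤ 1)
    (hxy : x + c * x * (1 - x) ≤ y) :
    gainPotential y ≤ Real.exp (-c / 2) * gainPotential x := by
  have hle : x ≤ y := by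
    have : 0 ≤ c * x * (1 - x) := mul_nonneg (by positivity) (by linarith)
    linarith
  have hexp := cubic_le_exp_neg_half hc0.le hc1
  unfold gainPotential
  by_cases hx : x ≤ 1 / 2
  · by_cases hy : y ≤ 1 / 2
    · rw [if_pos hx, if_pos hy]
      have hδ : c / 8 + c ^ 2 / 30 ≤ 1 / 2 - x := by
        by_contra! hlt
        have hd : c / 8 + c ^ 2 / 30 ≤ c / 6 := by nlinarith
        have hsq : (1 / 2 - x) ^ 2 ≤ (1 / 6) ^ 2 :=
          pow_le_pow_left₀ (by linarith) (by linarith) 2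
        nlinarith [mul_le_mul_of_nonneg_left hsq hc0.le]
      have hr : Real.exp (c / 2) ≤ 1 + c * (1 - x) := by
        nlinarith [exp_half_le_cubic hc0.le hc1, mul_le_mul_of_nonneg_left hδ hc0.le]
      have hxy' : Real.exp (c / 2) * x ≤ y := by
        nlinarith [mul_le_mul_of_nonneg_right hr hx0.le]
      have hneg : Real.exp (-c / 2) = (Real.exp (c / 2))⁻¹ := by
        rw [← Real.exp_neg]; congr 1; ring
      have heq : Real.exp (-c / 2) * (1 / (2 * x)) = 1 / (2 * (Real.exp (c / 2) * x)) := by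
        rw [hneg]; field_simp
      rw [heq]
      exact one_div_le_one_div_of_le (by positivity) (by linarith)
    · rw [if_pos hx, if_neg hy, mul_one_div, le_div_iff₀ (by positivity)]
      have hpoly : 4 * x * (1 - x) * (1 - c * x) ≤ 1 - c / 2 + c ^ 2 / 8 - c ^ 3 / 40 := by
        obtain ⟨δ, rfl⟩ : ∃ δ, x = 1 / 2 - δ := ⟨1 / 2 - x, by ring⟩
        have hδ : 0 ≤ δ := by linarith
        have h1 : 0 ≤ c * δ * (2 * δ - 1 / 2) ^ 2 := by positivity
        have h2 : 0 ≤ c ^ 2 * (1 - c) := mul_nonneg (by positivity) (by linarith)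
        nlinarith [sq_nonneg (2 * δ - 5 / 16 * c), sq_nonneg c]
      nlinarith [mul_le_mul_of_nonneg_right hxy hx0.le]
  · have hy : ¬ y ≤ 1 / 2 := by linarith
    rw [if_neg hx, if_neg hy]
    have h1 : 1 - c * x ≤ Real.exp (-c / 2) := by
      nlinarith [Real.add_one_le_exp (-c / 2)]
    nlinarith [mul_le_mul_of_nonneg_right h1 (sub_nonneg.mpr hx1)]

/-- **Iterating the gain** (end of the proof of Corollary 3.10).
If `0 < c ≤ 1`, `0 < ε < 1/2`, and `(p_t)` is a `[0,1]`-valued sequence with `p_0 ≥ ε` and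
`p_{t+1} ≥ p_t + c p_t (1 - p_t)`, then `p_t ≥ 1 - ε` once `t ≥ (4/c) log(1/(2ε))`. -/
theorem iterate_gain (c ε : ℝ) (hc0 : 0 < c) (hc1 : c ≤ 1) (hε0 : 0 < ε) (hε : ε < 1 / 2)
    (p : ℕ → ℝ) (hp0 : ∀ t, 0 ≤ p t) (hp1 : ∀ t, p t ≤ 1) (hinit : ε ≤ p 0)
    (hrec : ∀ t, p t + c * p t * (1 - p t) ≤ p (t + 1)) :
    ∀ t : ℕ, (4 / c) * Real.log (1 / (2 * ε)) ≤ t → 1 - ε ≤ p t := by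
  have hpos : ∀ t, 0 < p t := by
    intro t
    induction t with
    | zero => linarith
    | succ t ih =>
      have : 0 ≤ c * p t * (1 - p t) := mul_nonneg (by positivity) (by linarith [hp1 t])
      linarith [hrec t]
  have hpot : ∀ t : ℕ, gainPotential (p t) ≤ Real.exp (-c / 2) ^ t * (1 / (2 * ε)) := by
    intro t
    induction t with
    | zero =>
      rw [pow_zero, one_mul]
      unfold gainPotential
      split_ifs with h
      · exact one_div_le_one_div_of_le (by positivity) (by linarith)
      · have : 1 ≤ 1 / (2 * ε) := by
          rw [le_div_iff₀ (by positivity)]; linarith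
        linarith
    | succ t ih =>
      calc gainPotential (p (t + 1)) ≤ Real.exp (-c / 2) * gainPotential (p t) :=
            gainPotential_step hc0 hc1 (hpos t) (hp1 t) (hrec t)
        _ ≤ Real.exp (-c / 2) * (Real.exp (-c / 2) ^ t * (1 / (2 * ε))) := by gcongr
        _ = Real.exp (-c / 2) ^ (t + 1) * (1 / (2 * ε)) := by ring
  intro t ht
  have hdecay : Real.exp (-c / 2) ^ t ≤ (2 * ε) ^ 2 := by
    rw [← Real.exp_nat_mul, ← Real.le_log_iff_exp_le (by positivity), Real.log_pow]
    rw [one_div, Real.log_inv, div_mul_eq_mul_div, div_le_iff₀ hc0] at ht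
    push_cast
    linarith
  have hfinal : gainPotential (p t) ≤ 2 * ε := by
    calc gainPotential (p t) ≤ Real.exp (-c / 2) ^ t * (1 / (2 * ε)) := hpot t
      _ ≤ (2 * ε) ^ 2 * (1 / (2 * ε)) := by gcongr
      _ = 2 * ε := by field_simp
  unfold gainPotential at hfinal
  split_ifs at hfinal with h
  · rw [div_le_iff₀ (by linarith [hpos t])] at hfinal
    nlinarith [hpos t]
  · linarith
end

section
/- Let ν be a fully supported probability measure on Σ^n, let j_0, j_1, …, j_k ∈ [n] be (not necessarily distinct) coordinates, and let A and B each be a composition (in any order, with any multiplicities) of operators from {P_{j_0}, …, P_{j_k}}. Then for every f : Σ^n → ℝ and every x ∈ Σ^n, |((AB − BA) f)(x)| ≤ (k+1) · max{|f(z) − f(z')| : z, z' ∈ K(x), d_H(z,z') = 1}, where K(x) = {y ∈ Σ^n : y_j = x_j for all j ∉ {j_0,…,j_k}} and d_H is the Hamming distance. -/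
open scoped Classical BigOperators

noncomputable section

variable {σ : Type} [Fintype σ] [DecidableEq σ] {n : ℕ}

/-- The Markov (resampling) operator `P_i` as a matrix:
`(P_i)_{x,y} = Pr[X = y | X_j = x_j ∀ j ≠ i]`. -/
def Pmat (ν : Cfg σ n → ℝ) (i : Fin n) : Matrix (Cfg σ n) (Cfg σ n) ℝ :=
  Matrix.of fun x y =>
    if ∀ j, j ≠ i → y j = x j then
      ν y / ∑ z ∈ Finset.univ.filter (fun z : Cfg σ n => ∀ j, j ≠ i → z j = x j), ν z
    else 0

/-- `L_i = P_i - I` as a matrix. -/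
def Lmat (ν : Cfg σ n → ℝ) (i : Fin n) : Matrix (Cfg σ n) (Cfg σ n) ℝ :=
  Pmat ν i - 1

/-- The index sets `S_{k,i}`: tuples `(j_1,…,j_k)` with
`j_ℓ ∈ N⁺({i, j_1, …, j_{ℓ-1}})` for all `ℓ`, where `N⁺(U)` is `U` together with all
neighbors of `U` in `G`. -/
def Sset {m : ℕ} (G : SimpleGraph (Fin m)) (k : ℕ) (i : Fin m) : Finset (Fin k → Fin m) :=
  Finset.univ.filter fun jj => ∀ ℓ : Fin k,
    jj ℓ = i ∨ G.Adj i (jj ℓ) ∨ ∃ m' : Fin k, m' < ℓ ∧ (jj ℓ = jj m' ∨ G.Adj (jj m') (jj ℓ))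

/-- The iterated commutator `[⋯[[[P_i, P_{j_1}], P_{j_2}], P_{j_3}] ⋯, P_{j_k}]`. -/
def iterComm (ν : Cfg σ n → ℝ) (i : Fin n) :
    (k : ℕ) → (Fin k → Fin n) → Matrix (Cfg σ n) (Cfg σ n) ℝ
  | 0, _ => Pmat ν i
  | (k + 1), jj =>
      iterComm ν i k (fun ℓ => jj ℓ.castSucc) * Pmat ν (jj (Fin.last k)) -
        Pmat ν (jj (Fin.last k)) * iterComm ν i k (fun ℓ => jj ℓ.castSucc)

/-- `M` averages over the block `S`: the value of `M f` at `x` is at most any upper bound of `f`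
on the configurations agreeing with `x` outside `S`. -/
def AveragesOn (S : Finset (Fin n)) (M : Matrix (Cfg σ n) (Cfg σ n) ℝ) : Prop :=
  ∀ (f : Cfg σ n → ℝ) (x : Cfg σ n) (c : ℝ),
    (∀ y : Cfg σ n, (∀ l, l ∉ S → y l = x l) → f y ≤ c) → M.mulVec f x ≤ c

lemma AveragesOn.one (S : Finset (Fin n)) :
    AveragesOn S (1 : Matrix (Cfg σ n) (Cfg σ n) ℝ) := by
  intro f x c h
  rw [Matrix.one_mulVec]
  exact h x fun _ _ => rfl

lemma AveragesOn.mul {S : Finset (Fin n)} {M N : Matrix (Cfg σ n) (Cfg σ n) ℝ}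
    (hM : AveragesOn S M) (hN : AveragesOn S N) : AveragesOn S (M * N) := by
  intro f x c h
  rw [← Matrix.mulVec_mulVec]
  refine hM _ _ _ fun y hy => hN _ _ _ fun z hz => h z fun l hl => ?_
  rw [hz l hl, hy l hl]

lemma AveragesOn.list_prod {S : Finset (Fin n)} {L : List (Matrix (Cfg σ n) (Cfg σ n) ℝ)}
    (h : ∀ M ∈ L, AveragesOn S M) : AveragesOn S L.prod := by
  induction L with
  | nil => exact AveragesOn.one S
  | cons M L ih =>
    rw [List.prod_cons]
    exact (h M (by simp)).mul (ih fun N hN => h N (by simp [hN]))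

lemma AveragesOn.le_mulVec {S : Finset (Fin n)} {M : Matrix (Cfg σ n) (Cfg σ n) ℝ}
    (hM : AveragesOn S M) {f : Cfg σ n → ℝ} {x : Cfg σ n} {c : ℝ}
    (h : ∀ y : Cfg σ n, (∀ l, l ∉ S → y l = x l) → c ≤ f y) : c ≤ M.mulVec f x := by
  have := hM (-f) x (-c) fun y hy => neg_le_neg (h y hy)
  rw [Matrix.mulVec_neg, Pi.neg_apply] at this
  linarith

lemma averagesOn_Pmat {ν : Cfg σ n → ℝ} (hν : IsProb ν) {S : Finset (Fin n)} {i : Fin n}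
    (hi : i ∈ S) : AveragesOn S (Pmat ν i) := by
  intro f x c h
  set T := Finset.univ.filter (fun z : Cfg σ n => ∀ j, j ≠ i → z j = x j) with hT
  have hpos : 0 < ∑ z ∈ T, ν z :=
    Finset.sum_pos (fun z _ => hν.1 z) ⟨x, by simp [hT]⟩
  have hval : (Pmat ν i).mulVec f x = (∑ y ∈ T, ν y * f y) / ∑ z ∈ T, ν z := by
    simp only [Matrix.mulVec, dotProduct, Pmat, Matrix.of_apply, ite_mul, zero_mul]
    rw [← Finset.sum_filter, Finset.sum_div]
    exact Finset.sum_congr rfl fun y _ => div_mul_eq_mul_div _ _ _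
  rw [hval, div_le_iff₀ hpos, mul_comm, Finset.sum_mul]
  refine Finset.sum_le_sum fun y hy => mul_le_mul_of_nonneg_left (h y fun l hl => ?_) (hν.1 y).le
  exact (Finset.mem_filter.1 hy).2 l fun hli => hl (hli ▸ hi)

lemma hammingDist_update_of_ne {y : Cfg σ n} {a : Fin n} {b : σ} (h : y a ≠ b) :
    hammingDist y (Function.update y a b) = 1 := by
  rw [hammingDist, Finset.card_eq_one]
  refine ⟨a, ?_⟩
  ext j
  by_cases hj : j = a
  · subst hj
    simpa using h
  · simp [hj]

/-- Changing the coordinates in `S` one at a time, `f` moves by at most `D` at each step. -/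
lemma abs_sub_le_card_mul {f : Cfg σ n → ℝ} {D : ℝ} (hD : 0 ≤ D) {U : Finset (Fin n)}
    {x : Cfg σ n}
    (hf : ∀ y z : Cfg σ n, (∀ l, l ∉ U → y l = x l) → (∀ l, l ∉ U → z l = x l) →
      hammingDist y z = 1 → |f y - f z| ≤ D)
    (S : Finset (Fin n)) {y z : Cfg σ n} (hy : ∀ l, l ∉ U → y l = x l)
    (hz : ∀ l, l ∉ U → z l = x l) (hyz : ∀ l, l ∉ S → y l = z l) :
    |f y - f z| ≤ S.card * D := by
  induction S using Finset.induction_on generalizing y with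
  | empty =>
    obtain rfl : y = z := funext fun l => hyz l (Finset.notMem_empty l)
    simp
  | insert a S ha ih =>
    have hw : ∀ l, l ∉ U → Function.update y a (z a) l = x l := by
      intro l hl
      by_cases hla : l = a
      · subst hla
        simpa using hz l hl
      · simpa [hla] using hy l hl
    have h₁ : |f y - f (Function.update y a (z a))| ≤ D := by
      by_cases h : y a = z a
      · rw [← h, Function.update_eq_self, sub_self, abs_zero]
        exact hD
      · exact hf _ _ hy hw (hammingDist_update_of_ne h)
    have h₂ : |f (Function.update y a (z a)) - f z| ≤ S.card * D := by
      refine ih hw fun l hl => ?_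
      by_cases hla : l = a
      · subst hla
        simp
      · simpa [hla] using hyz l (by simp [hla, hl])
    rw [Finset.card_insert_of_notMem ha]
    push_cast
    linarith [abs_sub_le (f y) (f (Function.update y a (z a))) (f z)]

/-- **Commutators of resampling operators only move within the updated block**
(from the proof of Lemma 3.4). Let `j_0, …, j_k` be coordinates and let `A`, `B` be arbitrary
compositions (any order, any multiplicities) of the operators `P_{j_0}, …, P_{j_k}`. Then for
every `f` and `x`, `|((AB - BA)f)(x)| ≤ (k+1) · max{|f(z) - f(z')| : z, z' ∈ K(x), d_H(z,z') = 1}`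
where `K(x)` is the set of configurations agreeing with `x` outside `{j_0,…,j_k}` (the maximum
over an empty collection being `0`). -/
theorem commutator_pointwise_bound {σ : Type} [Fintype σ] [DecidableEq σ] {n : ℕ}
    (ν : Cfg σ n → ℝ) (hν : IsProb ν) (k : ℕ) (jj : Fin (k + 1) → Fin n)
    (lA lB : List (Fin (k + 1))) (f : Cfg σ n → ℝ) (x : Cfg σ n) :
    |((((lA.map fun r => Pmat ν (jj r)).prod * (lB.map fun r => Pmat ν (jj r)).prod -
          (lB.map fun r => Pmat ν (jj r)).prod * (lA.map fun r => Pmat ν (jj r)).prod)).mulVec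
        f) x| ≤
      ((k : ℝ) + 1) *
        ⨆ zz ∈ Finset.univ.filter (fun zz : Cfg σ n × Cfg σ n =>
            (∀ l, (∀ r, l ≠ jj r) → zz.1 l = x l) ∧
            (∀ l, (∀ r, l ≠ jj r) → zz.2 l = x l) ∧
            hammingDist zz.1 zz.2 = 1),
          |f zz.1 - f zz.2| := by
  set D : ℝ := ⨆ zz ∈ Finset.univ.filter (fun zz : Cfg σ n × Cfg σ n =>
      (∀ l, (∀ r, l ≠ jj r) → zz.1 l = x l) ∧
      (∀ l, (∀ r, l ≠ jj r) → zz.2 l = x l) ∧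
      hammingDist zz.1 zz.2 = 1), |f zz.1 - f zz.2| with hDdef
  have hD : 0 ≤ D := Real.iSup_nonneg fun _ => Real.iSup_nonneg fun _ => abs_nonneg _
  set U : Finset (Fin n) := Finset.univ.image jj with hU
  have hmem : ∀ l, l ∉ U ↔ ∀ r, l ≠ jj r := fun l => by simp [hU, eq_comm]
  have hf : ∀ y z : Cfg σ n, (∀ l, l ∉ U → y l = x l) → (∀ l, l ∉ U → z l = x l) →
      hammingDist y z = 1 → |f y - f z| ≤ D := by
    intro y z hy hz hyz
    simp only [hmem] at hy hz
    have hyz' : (y, z) ∈ Finset.univ.filter (fun zz : Cfg σ n × Cfg σ n =>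
        (∀ l, (∀ r, l ≠ jj r) → zz.1 l = x l) ∧
        (∀ l, (∀ r, l ≠ jj r) → zz.2 l = x l) ∧
        hammingDist zz.1 zz.2 = 1) :=
      Finset.mem_filter.2 ⟨Finset.mem_univ _, hy, hz, hyz⟩
    refine le_trans (le_of_eq ?_) (le_ciSup (Set.finite_range _).bddAbove (y, z))
    rw [ciSup_pos hyz']
  have hcard : (U.card : ℝ) ≤ (k : ℝ) + 1 := by
    have : U.card ≤ k + 1 := by simpa using Finset.card_image_le (s := Finset.univ) (f := jj)
    exact_mod_cast this
  have hosc : ∀ y z : Cfg σ n, (∀ l, l ∉ U → y l = x l) → (∀ l, l ∉ U → z l = x l) →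
      f y ≤ f z + ((k : ℝ) + 1) * D := by
    intro y z hy hz
    have h := abs_sub_le_card_mul hD hf U hy hz fun l hl => (hy l hl).trans (hz l hl).symm
    linarith [le_abs_self (f y - f z), mul_le_mul_of_nonneg_right hcard hD]
  have hav : ∀ L : List (Fin (k + 1)), AveragesOn U (L.map fun r => Pmat ν (jj r)).prod := by
    intro L
    refine AveragesOn.list_prod fun M hM => ?_
    obtain ⟨r, -, rfl⟩ := List.mem_map.1 hM
    exact averagesOn_Pmat hν (Finset.mem_image_of_mem jj (Finset.mem_univ r))
  have key : ∀ {M N : Matrix (Cfg σ n) (Cfg σ n) ℝ}, AveragesOn U M → AveragesOn U N →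
      M.mulVec f x ≤ N.mulVec f x + ((k : ℝ) + 1) * D := by
    intro M N hM hN
    rw [← sub_le_iff_le_add]
    refine hN.le_mulVec fun z hz => ?_
    rw [sub_le_iff_le_add]
    exact hM _ _ _ fun y hy => hosc y z hy hz
  have hAB := (hav lA).mul (hav lB)
  have hBA := (hav lB).mul (hav lA)
  rw [Matrix.sub_mulVec, Pi.sub_apply, abs_sub_le_iff]
  constructor <;> linarith [key hAB hBA, key hBA hAB]
end
end

section
/- Let ν be a fully supported, b-marginally bounded probability measure on Σ^n with q = |Σ|. Let j_0, j_1, …, j_k ∈ [n] be (not necessarily distinct) coordinates and let P_α be a composition of the operators P_{j_0}, …, P_{j_{k−1}}, each appearing exactly once, in any order. Then for every p ≥ 1 and every f : Σ^n → ℝ, ‖(P_{j_k} P_α − P_α P_{j_k}) f‖_p ≤ 2·(k+1)²·(qb)^{k+1} · max_{0 ≤ r ≤ k} ‖L_{j_r} f‖_p. -/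
open scoped Classical BigOperators

noncomputable section

variable {σ : Type} [Fintype σ] [DecidableEq σ] {n : ℕ}

set_option linter.unusedSectionVars false

/-- Minkowski's inequality for the weighted norm `pnorm`. -/
theorem pnorm_add_le {ν : Cfg σ n → ℝ} (hν : ∀ x, 0 ≤ ν x) {p : ℝ} (hp : 1 ≤ p)
    (f g : Cfg σ n → ℝ) : pnorm ν p (f + g) ≤ pnorm ν p f + pnorm ν p g := by
  have weight (h : Cfg σ n → ℝ) (x : Cfg σ n) :
      ν x * |h x| ^ p = |ν x ^ (1 / p) * h x| ^ p := by
    rw [abs_mul, abs_of_nonneg (Real.rpow_nonneg (hν x) _),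
      Real.mul_rpow (Real.rpow_nonneg (hν x) _) (abs_nonneg _), ← Real.rpow_mul (hν x),
      one_div_mul_cancel (by positivity), Real.rpow_one]
  simp only [pnorm, weight]
  simp only [Pi.add_apply, mul_add]
  exact Real.Lp_add_le _ _ _ hp

theorem pnorm_neg (ν : Cfg σ n → ℝ) (p : ℝ) (f : Cfg σ n → ℝ) :
    pnorm ν p (-f) = pnorm ν p f := by
  simp [pnorm]

theorem pnorm_sub_le {ν : Cfg σ n → ℝ} (hν : ∀ x, 0 ≤ ν x) {p : ℝ} (hp : 1 ≤ p)
    (f g : Cfg σ n → ℝ) : pnorm ν p (f - g) ≤ pnorm ν p f + pnorm ν p g := by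
  simpa [sub_eq_add_neg, pnorm_neg] using pnorm_add_le hν hp f (-g)

theorem pnorm_nonneg {ν : Cfg σ n → ℝ} (hν : ∀ x, 0 ≤ ν x) (p : ℝ) (f : Cfg σ n → ℝ) :
    0 ≤ pnorm ν p f :=
  Real.rpow_nonneg
    (Finset.sum_nonneg fun x _ => mul_nonneg (hν x) (Real.rpow_nonneg (abs_nonneg _) _)) _

/-- A Markov operator with stationary measure `ν` contracts `pnorm ν p`. -/
theorem pnorm_mulVec_le {ν : Cfg σ n → ℝ} (hν : ∀ x, 0 ≤ ν x) {p : ℝ} (hp : 1 ≤ p)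
    {M : Matrix (Cfg σ n) (Cfg σ n) ℝ} (hM : ∀ x y, 0 ≤ M x y) (hrow : ∀ x, ∑ y, M x y = 1)
    (hstat : ∀ y, ∑ x, ν x * M x y = ν y) (f : Cfg σ n → ℝ) :
    pnorm ν p (M.mulVec f) ≤ pnorm ν p f := by
  have jensen (x : Cfg σ n) : |M.mulVec f x| ^ p ≤ ∑ y, M x y * |f y| ^ p := by
    refine le_trans (Real.rpow_le_rpow (abs_nonneg _) ?_ (by positivity))
      (Real.rpow_arith_mean_le_arith_mean_rpow Finset.univ (M x) (fun y => |f y|)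
        (fun y _ => hM x y) (hrow x) (fun y _ => abs_nonneg _) hp)
    refine (Finset.abs_sum_le_sum_abs _ _).trans (le_of_eq ?_)
    simp only [abs_mul, abs_of_nonneg (hM x _)]
  refine Real.rpow_le_rpow
    (Finset.sum_nonneg fun x _ => mul_nonneg (hν x) (Real.rpow_nonneg (abs_nonneg _) _)) ?_
    (by positivity)
  calc ∑ x, ν x * |M.mulVec f x| ^ p
      ≤ ∑ x, ν x * ∑ y, M x y * |f y| ^ p :=
        Finset.sum_le_sum fun x _ => mul_le_mul_of_nonneg_left (jensen x) (hν x)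
    _ = ∑ y, (∑ x, ν x * M x y) * |f y| ^ p := by
        simp only [Finset.mul_sum, Finset.sum_mul, mul_assoc]
        exact Finset.sum_comm
    _ = ∑ y, ν y * |f y| ^ p := by simp only [hstat]

theorem Pmat_nonneg {ν : Cfg σ n → ℝ} (hν : ∀ x, 0 ≤ ν x) (i : Fin n) (x y : Cfg σ n) :
    0 ≤ Pmat ν i x y := by
  simp only [Pmat, Matrix.of_apply]
  split_ifs
  · exact div_nonneg (hν y) (Finset.sum_nonneg fun z _ => hν z)
  · exact le_rfl

theorem Pmat_mulVec (ν : Cfg σ n → ℝ) (i : Fin n) (f : Cfg σ n → ℝ) :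
    (Pmat ν i).mulVec f = Pop ν i f := by
  ext x
  simp only [Matrix.mulVec, dotProduct, Pmat, Pop, Matrix.of_apply, ite_mul, zero_mul,
    Finset.sum_div, Finset.sum_filter]
  refine Finset.sum_congr rfl fun y _ => ?_
  split_ifs
  · rw [div_mul_eq_mul_div]
  · simp

theorem Pmat_row_sum {ν : Cfg σ n → ℝ} (hν : ∀ x, 0 < ν x) (i : Fin n) (x : Cfg σ n) :
    ∑ y, Pmat ν i x y = 1 := by
  have h := congrFun (Pmat_mulVec ν i (fun _ => 1)) x
  simp only [Matrix.mulVec, dotProduct, Pop, mul_one] at h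
  rw [h]
  exact div_self (Finset.sum_pos (fun z _ => hν z) ⟨x, by simp⟩).ne'

/-- Detailed balance for `Pmat`. -/
theorem mul_Pmat_comm (ν : Cfg σ n → ℝ) (i : Fin n) (x y : Cfg σ n) :
    ν x * Pmat ν i x y = ν y * Pmat ν i y x := by
  simp only [Pmat, Matrix.of_apply]
  by_cases h : ∀ j, j ≠ i → y j = x j
  · have h' : ∀ j, j ≠ i → x j = y j := fun j hj => (h j hj).symm
    have hz : ∀ z : Cfg σ n, (∀ j, j ≠ i → z j = x j) ↔ ∀ j, j ≠ i → z j = y j := fun z =>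
      forall₂_congr fun j hj => by rw [h j hj]
    rw [if_pos h, if_pos h']
    simp only [hz]
    ring
  · have h' : ¬ ∀ j, j ≠ i → x j = y j := fun h' => h fun j hj => (h' j hj).symm
    rw [if_neg h, if_neg h']
    simp

theorem pnorm_Pmat_mulVec_le {ν : Cfg σ n → ℝ} (hν : ∀ x, 0 < ν x) {p : ℝ} (hp : 1 ≤ p)
    (i : Fin n) (f : Cfg σ n → ℝ) : pnorm ν p ((Pmat ν i).mulVec f) ≤ pnorm ν p f :=
  pnorm_mulVec_le (fun x => (hν x).le) hp (Pmat_nonneg (fun x => (hν x).le) i)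
    (Pmat_row_sum hν i)
    (fun y => by
      simp only [mul_Pmat_comm ν i _ y, ← Finset.mul_sum, Pmat_row_sum hν i y, mul_one]) f

theorem pnorm_list_prod_mulVec_le {ν : Cfg σ n → ℝ} {p : ℝ}
    {l : List (Matrix (Cfg σ n) (Cfg σ n) ℝ)}
    (hl : ∀ M ∈ l, ∀ f, pnorm ν p (M.mulVec f) ≤ pnorm ν p f) (f : Cfg σ n → ℝ) :
    pnorm ν p (l.prod.mulVec f) ≤ pnorm ν p f := by
  induction l with
  | nil => simp
  | cons M l ih =>
    rw [List.prod_cons, ← Matrix.mulVec_mulVec]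
    exact (hl M (by simp) _).trans (ih fun N hN => hl N (by simp [hN]))

/-- Telescoping bound for a product of contractions, each of which moves `f` by at most `C`. -/
theorem pnorm_list_prod_mulVec_sub_le {ν : Cfg σ n → ℝ} (hν : ∀ x, 0 ≤ ν x) {p : ℝ} (hp : 1 ≤ p)
    {l : List (Matrix (Cfg σ n) (Cfg σ n) ℝ)}
    (hl : ∀ M ∈ l, ∀ f, pnorm ν p (M.mulVec f) ≤ pnorm ν p f) {f : Cfg σ n → ℝ} {C : ℝ}
    (hC : ∀ M ∈ l, pnorm ν p (M.mulVec f - f) ≤ C) :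
    pnorm ν p (l.prod.mulVec f - f) ≤ l.length * C := by
  induction l with
  | nil =>
    have hp' : p ≠ 0 := by positivity
    simp [pnorm, Real.zero_rpow hp', Real.zero_rpow (inv_ne_zero hp')]
  | cons M l ih =>
    have split : (M :: l).prod.mulVec f - f =
        M.mulVec (l.prod.mulVec f - f) + (M.mulVec f - f) := by
      rw [List.prod_cons, ← Matrix.mulVec_mulVec, Matrix.mulVec_sub]
      abel
    rw [split]
    have hprod := ih (fun N hN => hl N (by simp [hN])) (fun N hN => hC N (by simp [hN]))
    have hadd := pnorm_add_le hν hp (M.mulVec (l.prod.mulVec f - f)) (M.mulVec f - f)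
    have hcontr := hl M (by simp) (l.prod.mulVec f - f)
    have hM := hC M (by simp)
    push_cast [List.length_cons]
    linarith

/-- **`L_p` bound for a single commutator** (from the proof of Lemma 3.4).
Let `ν` be fully supported and `b`-marginally bounded (`q = |Σ|`), let `j_0, …, j_k` be
coordinates and let `P_α` be a composition of `P_{j_0}, …, P_{j_{k-1}}`, each appearing exactly
once, in any order (given by a permutation `π` of `{0,…,k-1}`). Then for every `p ≥ 1` and `f`,
`‖(P_{j_k} P_α - P_α P_{j_k}) f‖_p ≤ 2 (k+1)² (qb)^{k+1} max_{0 ≤ r ≤ k} ‖L_{j_r} f‖_p`. -/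
theorem single_commutator_pnorm_bound {σ : Type} [Fintype σ] [DecidableEq σ] {n : ℕ}
    (ν : Cfg σ n → ℝ) (hν : IsProb ν) (b : ℝ) (hb : 1 ≤ b) (hmb : MargBounded ν b)
    (k : ℕ) (jj : Fin (k + 1) → Fin n) (π : Equiv.Perm (Fin k))
    (p : ℝ) (hp : 1 ≤ p) (f : Cfg σ n → ℝ) :
    pnorm ν p
        ((Pmat ν (jj (Fin.last k)) *
              (List.ofFn fun r : Fin k => Pmat ν (jj ((π r).castSucc))).prod -
            (List.ofFn fun r : Fin k => Pmat ν (jj ((π r).castSucc))).prod *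
              Pmat ν (jj (Fin.last k))).mulVec f) ≤
      2 * ((k : ℝ) + 1) ^ 2 * ((Fintype.card σ : ℝ) * b) ^ (k + 1) *
        Finset.univ.sup' Finset.univ_nonempty
          (fun r : Fin (k + 1) => pnorm ν p (Lop ν (jj r) f)) := by
  have hν₀ : ∀ x, 0 ≤ ν x := fun x => (hν.1 x).le
  set C := Finset.univ.sup' Finset.univ_nonempty
    (fun r : Fin (k + 1) => pnorm ν p (Lop ν (jj r) f))
  have hLop : ∀ r, pnorm ν p ((Pmat ν (jj r)).mulVec f - f) ≤ C := fun r => by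
    rw [Pmat_mulVec]
    exact Finset.le_sup' (fun r => pnorm ν p (Lop ν (jj r) f)) (Finset.mem_univ r)
  have hC : 0 ≤ C := (pnorm_nonneg hν₀ p _).trans (hLop (Fin.last k))
  set l := List.ofFn fun r : Fin k => Pmat ν (jj ((π r).castSucc)) with hl
  have hcontr : ∀ M ∈ l, ∀ g, pnorm ν p (M.mulVec g) ≤ pnorm ν p g := by
    simp only [hl, List.mem_ofFn]
    rintro _ ⟨r, rfl⟩ g
    exact pnorm_Pmat_mulVec_le hν.1 hp _ g
  have hprod : pnorm ν p (l.prod.mulVec f - f) ≤ k * C := by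
    have h := pnorm_list_prod_mulVec_sub_le hν₀ hp hcontr (f := f) (C := C) (by
      simp only [hl, List.mem_ofFn]
      rintro _ ⟨r, rfl⟩
      exact hLop _)
    rwa [hl, List.length_ofFn] at h
  set A := Pmat ν (jj (Fin.last k))
  have hA : pnorm ν p (A.mulVec f - f) ≤ C := hLop (Fin.last k)
  have split : (A * l.prod - l.prod * A).mulVec f =
      (A.mulVec (l.prod.mulVec f - f) + (A.mulVec f - f)) -
        (l.prod.mulVec (A.mulVec f - f) + (l.prod.mulVec f - f)) := by
    simp only [Matrix.sub_mulVec, Matrix.mulVec_sub, Matrix.mulVec_mulVec]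
    abel
  have bound : pnorm ν p ((A * l.prod - l.prod * A).mulVec f) ≤ 2 * ((k : ℝ) + 1) * C := by
    rw [split]
    have h₁ := pnorm_sub_le hν₀ hp (A.mulVec (l.prod.mulVec f - f) + (A.mulVec f - f))
      (l.prod.mulVec (A.mulVec f - f) + (l.prod.mulVec f - f))
    have h₂ := pnorm_add_le hν₀ hp (A.mulVec (l.prod.mulVec f - f)) (A.mulVec f - f)
    have h₃ := pnorm_add_le hν₀ hp (l.prod.mulVec (A.mulVec f - f)) (l.prod.mulVec f - f)
    have h₄ : pnorm ν p (A.mulVec (l.prod.mulVec f - f)) ≤ _ :=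
      pnorm_Pmat_mulVec_le hν.1 hp _ _
    have h₅ := pnorm_list_prod_mulVec_le hcontr (A.mulVec f - f)
    linarith
  have hcard : (1 : ℝ) ≤ Fintype.card σ := by
    obtain ⟨x, -⟩ : (Finset.univ : Finset (Cfg σ n)).Nonempty :=
      Finset.nonempty_of_sum_ne_zero (f := ν) (by rw [hν.2]; exact one_ne_zero)
    exact_mod_cast Fintype.card_pos_iff.2 ⟨x (jj 0)⟩
  refine bound.trans (mul_le_mul_of_nonneg_right ?_ hC)
  have hpow : 1 ≤ ((Fintype.card σ : ℝ) * b) ^ (k + 1) :=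
    one_le_pow₀ (one_le_mul_of_one_le_of_one_le hcard hb)
  have hk : ((k : ℝ) + 1) ≤ ((k : ℝ) + 1) ^ 2 := le_self_pow₀ (by simp) two_ne_zero
  calc 2 * ((k : ℝ) + 1) ≤ 2 * ((k : ℝ) + 1) ^ 2 := by linarith
    _ ≤ _ := le_mul_of_one_le_right (by positivity) hpow
end
end

section
/- Let G be a graph on vertex set [n] and let P_1, …, P_n be linear operators on a finite-dimensional real vector space such that P_i and P_j commute whenever i ≠ j are non-adjacent in G. Set L_i = P_i − I and L = Σ_{i=1}^n L_i, and define iterated commutators by [L_i, L]^{(0)} = L_i and [L_i, L]^{(k)} = [[L_i, L]^{(k−1)}, L]. Then for every i ∈ [n] and k ≥ 1, [L_i, L]^{(k)} = Σ_{(j_1,…,j_k) ∈ S_{k,i}} [⋯[[[P_i, P_{j_1}], P_{j_2}], P_{j_3}] ⋯, P_{j_k}]. -/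
open scoped Classical BigOperators

noncomputable section

variable {V : Type} [AddCommGroup V] [Module ℝ V]

/-- The iterated commutator `[L_i, L]^{(k)}`: `[L_i,L]^{(0)} = L_i` and
`[L_i,L]^{(k)} = [[L_i,L]^{(k-1)}, L]`. -/
def iterLL (Li L : Module.End ℝ V) : ℕ → Module.End ℝ V
  | 0 => Li
  | (k + 1) => iterLL Li L k * L - L * iterLL Li L k

/-- The iterated commutator `[⋯[[[P_i, P_{j_1}], P_{j_2}], P_{j_3}] ⋯, P_{j_k}]`. -/
def iterCommE {m : ℕ} (P : Fin m → Module.End ℝ V) (i : Fin m) :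
    (k : ℕ) → (Fin k → Fin m) → Module.End ℝ V
  | 0, _ => P i
  | (k + 1), jj =>
      iterCommE P i k (fun ℓ => jj ℓ.castSucc) * P (jj (Fin.last k)) -
        P (jj (Fin.last k)) * iterCommE P i k (fun ℓ => jj ℓ.castSucc)

/-- Shifting both arguments by scalars does not change the iterated commutator of order `≥ 1`. -/
theorem iterLL_sub_one_sum {n : ℕ} (P : Fin n → Module.End ℝ V) (A : Module.End ℝ V) (k : ℕ) :
    iterLL (A - 1) (∑ t, (P t - 1)) (k + 1) = iterLL A (∑ t, P t) (k + 1) := by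
  have hL : ∑ t, (P t - 1) = ∑ t, P t - (n : Module.End ℝ V) := by simp
  have hn (B : Module.End ℝ V) : B * (n : Module.End ℝ V) = n * B :=
    ((Nat.cast_commute n B).eq).symm
  induction k with
  | zero =>
    simp only [iterLL, hL, sub_mul, mul_sub, hn, one_mul, mul_one]
    abel
  | succ k ih =>
    rw [iterLL, ih, iterLL.eq_2 A _ (k + 1), hL, mul_sub, sub_mul, hn]
    abel

/-- Multilinear expansion of the iterated commutator over all index tuples. -/
theorem iterLL_sum_eq_sum_iterCommE {n : ℕ} (P : Fin n → Module.End ℝ V) (i : Fin n) (k : ℕ) :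
    iterLL (P i) (∑ t, P t) k = ∑ jj : Fin k → Fin n, iterCommE P i k jj := by
  induction k with
  | zero => simp [iterLL, iterCommE]
  | succ k ih =>
    rw [← (Fin.snocEquiv fun _ : Fin (k + 1) => Fin n).sum_comp, Fintype.sum_prod_type_right]
    simp [iterLL, iterCommE, ih, Finset.sum_mul_sum, Finset.sum_sub_distrib, Fin.snocEquiv]
    exact Finset.sum_comm

/-- An operator commuting with all entries commutes with their iterated commutator. -/
theorem commute_iterCommE {n : ℕ} (P : Fin n → Module.End ℝ V) (i : Fin n)
    (Q : Module.End ℝ V) (hi : Commute (P i) Q) (k : ℕ) (jj : Fin k → Fin n)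
    (hjj : ∀ ℓ, Commute (P (jj ℓ)) Q) : Commute (iterCommE P i k jj) Q := by
  induction k with
  | zero => exact hi
  | succ k ih =>
    have hprefix := ih (fun ℓ => jj ℓ.castSucc) fun ℓ => hjj _
    have hlast := hjj (Fin.last k)
    exact (hprefix.mul_left hlast).sub_left (hlast.mul_left hprefix)

/-- The iterated commutator vanishes on tuples outside `S_{k,i}`. -/
theorem iterCommE_eq_zero_of_notMem_Sset {n : ℕ} (G : SimpleGraph (Fin n))
    (P : Fin n → Module.End ℝ V)
    (hcomm : ∀ i j : Fin n, i ≠ j → ¬ G.Adj i j → P i * P j = P j * P i)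
    (i : Fin n) (k : ℕ) (jj : Fin k → Fin n) (hjj : jj ∉ Sset G k i) :
    iterCommE P i k jj = 0 := by
  induction k with
  | zero => exact absurd (Finset.mem_filter.2 ⟨Finset.mem_univ _, fun ℓ => ℓ.elim0⟩) hjj
  | succ k ih =>
    simp only [Sset, Finset.mem_filter, Finset.mem_univ, true_and, not_forall, not_or,
      not_exists, not_and] at hjj
    obtain ⟨ℓ, hne, hadj, hprev⟩ := hjj
    induction ℓ using Fin.lastCases with
    | last =>
      refine sub_eq_zero.2 (commute_iterCommE P i _ (hcomm _ _ (Ne.symm hne) hadj) k _ fun ℓ => ?_)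
      obtain ⟨h1, h2⟩ := hprev ℓ.castSucc ℓ.castSucc_lt_last
      exact hcomm _ _ (Ne.symm h1) h2
    | cast ℓ =>
      have hzero : iterCommE P i k (fun ℓ => jj ℓ.castSucc) = 0 := by
        refine ih _ ?_
        simp only [Sset, Finset.mem_filter, Finset.mem_univ, true_and, not_forall, not_or,
          not_exists, not_and]
        exact ⟨ℓ, hne, hadj, fun m hm => hprev m.castSucc (Fin.castSucc_lt_castSucc_iff.2 hm)⟩
      simp [iterCommE, hzero]

/-- **Expansion of iterated commutators** (from the proof of Lemma 3.2).
Let `G` be a graph on `[n]` and `P_1, …, P_n` linear operators on a finite-dimensional real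
vector space such that `P_i` and `P_j` commute whenever `i ≠ j` are non-adjacent. With
`L_i = P_i - I` and `L = ∑_i L_i`, for every `i` and `k ≥ 1`,
`[L_i, L]^{(k)} = ∑_{(j_1,…,j_k) ∈ S_{k,i}} [⋯[[[P_i,P_{j_1}],P_{j_2}],P_{j_3}]⋯,P_{j_k}]`. -/
theorem iterated_commutator_expansion [FiniteDimensional ℝ V] {n : ℕ}
    (G : SimpleGraph (Fin n)) (P : Fin n → Module.End ℝ V)
    (hcomm : ∀ i j : Fin n, i ≠ j → ¬ G.Adj i j → P i * P j = P j * P i)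
    (i : Fin n) (k : ℕ) (hk : 1 ≤ k) :
    iterLL (P i - 1) (∑ t : Fin n, (P t - 1)) k =
      ∑ jj ∈ Sset G k i, iterCommE P i k jj := by
  obtain ⟨k, rfl⟩ := Nat.exists_eq_succ_of_ne_zero (Nat.one_le_iff_ne_zero.1 hk)
  rw [Nat.succ_eq_add_one, iterLL_sub_one_sum, iterLL_sum_eq_sum_iterCommE]
  exact (Finset.sum_subset (Finset.subset_univ _) fun jj _ hjj =>
    iterCommE_eq_zero_of_notMem_Sset G P hcomm i _ jj hjj).symm
end
end
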